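/- Let H be a complex Hilbert space and let v : ℝ → B(H) be a family of unitary operators such that t ↦ v_t ξ is continuous for every ξ ∈ H. For λ > 0 define m_λ ∈ B(H) by m_λ ξ = (2√λ)^{-1} ∫_ℝ λ^{-it} cosh(πt)^{-1} v_t ξ dt. Then for all ξ, η ∈ H, the function λ ↦ ⟨m_λ^* ξ, m_λ^* η⟩ is integrable on (0,∞) and ∫₀^∞ ⟨m_λ^* ξ, m_λ^* η⟩ dλ = ⟨ξ, η⟩, where m_λ^* denotes the Hilbert-space adjoint of m_λ. -/

import Mathlib

open MeasureTheory Real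
open scoped InnerProductSpace

open scoped FourierTransform SchwartzMap ContDiff

section Plancherel

variable {V F : Type*} [NormedAddCommGroup V] [InnerProductSpace ℝ V] [FiniteDimensional ℝ V]
  [MeasurableSpace V] [BorelSpace V] [NormedAddCommGroup F] [InnerProductSpace ℂ F]
  [CompleteSpace F]

omit [CompleteSpace F] in
/-- The Fourier integral of an integrable function is continuous. -/
theorem MeasureTheory.Integrable.continuous_fourier {f : V → F} (hf : Integrable f) :
    Continuous (𝓕 f) :=
  VectorFourier.fourierIntegral_continuous continuous_fourierChar
    (L := innerₗ V) continuous_inner hf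

/-- On `L¹ ∩ L²`, the Fourier transform on `L²` is given by the Fourier integral. -/
theorem MeasureTheory.MemLp.fourier_toLp_ae_eq {f : V → F} (hf : Integrable f)
    (hf₂ : MemLp f 2) : (𝓕 (hf₂.toLp f) : Lp F 2 (volume : Measure V)) =ᵐ[volume] 𝓕 f := by
  refine ae_eq_of_integral_contDiff_smul_eq
    ((Lp.memLp (𝓕 (hf₂.toLp f))).locallyIntegrable one_le_two)
    hf.continuous_fourier.locallyIntegrable fun g hg hgc => ?_
  have hc : HasCompactSupport (Complex.ofRealCLM ∘ g) := hgc.comp_left rfl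
  have hd : ContDiff ℝ ∞ (Complex.ofRealCLM ∘ g) := by fun_prop
  set φ : 𝓢(V, ℂ) := hc.toSchwartzMap hd
  have hφ (x : V) : φ x = (g x : ℂ) := rfl
  calc ∫ x, g x • (𝓕 (hf₂.toLp f) : Lp F 2 (volume : Measure V)) x
      = ((𝓕 (hf₂.toLp f) : Lp F 2 (volume : Measure V)) : 𝓢'(V, F)) φ := by
        simp [Lp.toTemperedDistribution_apply, hφ]
    _ = ∫ x, (𝓕 φ) x • f x := by
        rw [← Lp.fourier_toTemperedDistribution_eq, TemperedDistribution.fourier_apply,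
          Lp.toTemperedDistribution_apply]
        refine integral_congr_ae ?_
        filter_upwards [hf₂.coeFn_toLp] with x hx
        rw [hx]
    _ = ∫ x, φ x • 𝓕 f x := by
        have := VectorFourier.integral_fourierIntegral_smul_eq_flip (L := innerₗ V)
          continuous_fourierChar continuous_inner (φ.integrable (μ := volume)) hf
        rw [flip_innerₗ] at this
        exact this
    _ = ∫ x, g x • 𝓕 f x := by simp [hφ]

/-- Plancherel's theorem for functions in `L¹ ∩ L²`. -/
theorem integrable_inner_fourier_and_integral_eq {f g : V → F} (hf : Integrable f)
    (hf₂ : MemLp f 2) (hg : Integrable g) (hg₂ : MemLp g 2) :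
    Integrable (fun x => ⟪𝓕 f x, 𝓕 g x⟫_ℂ) ∧
      ∫ x, ⟪𝓕 f x, 𝓕 g x⟫_ℂ = ∫ x, ⟪f x, g x⟫_ℂ := by
  have key : (fun x => ⟪(𝓕 (hf₂.toLp f) : Lp F 2 (volume : Measure V)) x,
      (𝓕 (hg₂.toLp g) : Lp F 2 (volume : Measure V)) x⟫_ℂ) =ᵐ[volume]
      fun x => ⟪𝓕 f x, 𝓕 g x⟫_ℂ := by
    filter_upwards [hf₂.fourier_toLp_ae_eq hf, hg₂.fourier_toLp_ae_eq hg] with x h₁ h₂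
    rw [h₁, h₂]
  refine ⟨(L2.integrable_inner _ _).congr key, ?_⟩
  rw [← integral_congr_ae key, ← L2.inner_def, Lp.inner_fourier_eq, L2.inner_def]
  refine integral_congr_ae ?_
  filter_upwards [hf₂.coeFn_toLp, hg₂.coeFn_toLp] with x h₁ h₂
  rw [h₁, h₂]

end Plancherel

section Sech

theorem one_add_sq_half_le_cosh (x : ℝ) : 1 + 2 * (x / 2) ^ 2 ≤ cosh x := by
  have h : cosh x = 1 + 2 * sinh (x / 2) ^ 2 := by
    have h₁ := cosh_two_mul (x / 2)
    rw [mul_div_cancel₀ x two_ne_zero, cosh_sq] at h₁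
    linarith
  have h₂ : (x / 2) ^ 2 ≤ sinh (x / 2) ^ 2 := by
    rw [sq_le_sq, abs_sinh]
    exact self_le_sinh_iff.2 (abs_nonneg _)
  linarith

theorem continuous_inv_cosh_pi_mul : Continuous fun t : ℝ => (cosh (π * t))⁻¹ :=
  (by fun_prop : Continuous fun t : ℝ => cosh (π * t)).inv₀ fun _ => (cosh_pos _).ne'

theorem integrable_inv_cosh_pi_mul : Integrable fun t : ℝ => (cosh (π * t))⁻¹ := by
  refine integrable_inv_one_add_sq.mono' continuous_inv_cosh_pi_mul.aestronglyMeasurable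
    (.of_forall fun t => ?_)
  rw [norm_of_nonneg (inv_nonneg.2 (cosh_pos _).le)]
  gcongr
  have := one_add_sq_half_le_cosh (π * t)
  have hpi : 0 ≤ π ^ 2 - 9 := by nlinarith [pi_gt_three]
  nlinarith [sq_nonneg t, mul_nonneg (sq_nonneg t) hpi]

theorem integrable_inv_cosh_pi_mul_sq : Integrable fun t : ℝ => (cosh (π * t))⁻¹ ^ 2 := by
  refine integrable_inv_cosh_pi_mul.mono'
    (continuous_inv_cosh_pi_mul.pow 2).aestronglyMeasurable (.of_forall fun t => ?_)
  have h₀ : 0 ≤ (cosh (π * t))⁻¹ := inv_nonneg.2 (cosh_pos _).le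
  rw [norm_of_nonneg (pow_nonneg h₀ 2)]
  exact pow_le_of_le_one h₀ (inv_le_one_of_one_le₀ (one_le_cosh _)) two_ne_zero

theorem integral_inv_cosh_pi_mul_sq : ∫ t : ℝ, (cosh (π * t))⁻¹ ^ 2 = 2 / π := by
  have hd (t : ℝ) : HasDerivAt (fun t : ℝ => -(2 / π) * (exp (2 * π * t) + 1)⁻¹)
      ((cosh (π * t))⁻¹ ^ 2) t := by
    have h₁ : HasDerivAt (fun t : ℝ => exp (2 * π * t) + 1)
        (exp (2 * π * t) * (2 * π)) t := by
      simpa using (((hasDerivAt_id t).const_mul (2 * π)).exp).add_const 1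
    have hpos : 0 < exp (2 * π * t) + 1 := by positivity
    refine ((h₁.fun_inv hpos.ne').const_mul (-(2 / π))).congr_deriv ?_
    have he : exp (2 * π * t) = exp (π * t) ^ 2 := by rw [← exp_nat_mul]; congr 1; push_cast; ring
    rw [cosh_eq, exp_neg, he]
    have := exp_pos (π * t)
    field_simp
  have htop : Filter.Tendsto (fun t : ℝ => 2 * π * t) Filter.atTop Filter.atTop :=
    Filter.tendsto_id.const_mul_atTop (by positivity)
  have hbot : Filter.Tendsto (fun t : ℝ => 2 * π * t) Filter.atBot Filter.atBot :=
    Filter.tendsto_id.const_mul_atBot (by positivity)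
  have := integral_of_hasDerivAt_of_tendsto hd integrable_inv_cosh_pi_mul_sq
    ((((tendsto_exp_atBot.comp hbot).add_const 1).inv₀ (by norm_num)).const_mul _)
    ((Filter.tendsto_atTop_add_const_right _ 1
      (tendsto_exp_atTop.comp htop)).inv_tendsto_atTop.const_mul _)
  rw [this]
  norm_num

end Sech

section StarUnitary

variable {H : Type*} [NormedAddCommGroup H] [InnerProductSpace ℂ H] [CompleteSpace H]

theorem adjoint_apply_apply_of_mem_unitary {u : H →L[ℂ] H} (hu : u ∈ unitary (H →L[ℂ] H)) (x : H) :
    u.adjoint (u x) = x :=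
  DFunLike.congr_fun (Unitary.star_mul_self_of_mem hu) x

theorem apply_adjoint_apply_of_mem_unitary {u : H →L[ℂ] H} (hu : u ∈ unitary (H →L[ℂ] H)) (x : H) :
    u (u.adjoint x) = x :=
  DFunLike.congr_fun (Unitary.mul_star_self_of_mem hu) x

theorem inner_adjoint_apply_of_mem_unitary {u : H →L[ℂ] H} (hu : u ∈ unitary (H →L[ℂ] H))
    (x y : H) : ⟪u.adjoint x, u.adjoint y⟫_ℂ = ⟪x, y⟫_ℂ := by
  rw [ContinuousLinearMap.adjoint_inner_left, apply_adjoint_apply_of_mem_unitary hu]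

theorem norm_adjoint_apply_of_mem_unitary {u : H →L[ℂ] H} (hu : u ∈ unitary (H →L[ℂ] H))
    (x : H) : ‖u.adjoint x‖ = ‖x‖ := by
  rw [@norm_eq_sqrt_re_inner ℂ, @norm_eq_sqrt_re_inner ℂ _ _ _ _ x,
    inner_adjoint_apply_of_mem_unitary hu]

/-- On unitaries, taking adjoints is continuous for the strong operator topology. -/
theorem continuous_adjoint_apply_of_mem_unitary {X : Type*} [TopologicalSpace X]
    {v : X → (H →L[ℂ] H)} (hv : ∀ t, v t ∈ unitary (H →L[ℂ] H))
    (hvcont : ∀ ξ : H, Continuous fun t => v t ξ) (ξ : H) :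
    Continuous fun t => (v t).adjoint ξ := by
  refine continuous_iff_continuousAt.2 fun s => tendsto_iff_norm_sub_tendsto_zero.2 ?_
  have h := tendsto_iff_norm_sub_tendsto_zero.1 ((hvcont ((v s).adjoint ξ)).tendsto s)
  refine h.congr fun t => ?_
  rw [apply_adjoint_apply_of_mem_unitary (hv s), ← norm_adjoint_apply_of_mem_unitary (hv t),
    map_sub, adjoint_apply_apply_of_mem_unitary (hv t), norm_sub_rev]

theorem norm_inv_cosh_smul_adjoint_apply {v : ℝ → (H →L[ℂ] H)}
    (hv : ∀ t, v t ∈ unitary (H →L[ℂ] H)) (ξ : H) (t : ℝ) :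
    ‖(cosh (π * t))⁻¹ • (v t).adjoint ξ‖ = (cosh (π * t))⁻¹ * ‖ξ‖ := by
  rw [norm_smul, norm_of_nonneg (inv_nonneg.2 (cosh_pos _).le),
    norm_adjoint_apply_of_mem_unitary (hv t)]

theorem integrable_inv_cosh_smul_adjoint {v : ℝ → (H →L[ℂ] H)}
    (hv : ∀ t, v t ∈ unitary (H →L[ℂ] H)) (hvcont : ∀ ξ : H, Continuous fun t => v t ξ) (ξ : H) :
    Integrable fun t : ℝ => (cosh (π * t))⁻¹ • (v t).adjoint ξ :=
  (integrable_inv_cosh_pi_mul.mul_const ‖ξ‖).mono'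
    (continuous_inv_cosh_pi_mul.smul
      (continuous_adjoint_apply_of_mem_unitary hv hvcont ξ)).aestronglyMeasurable
    (.of_forall fun t => (norm_inv_cosh_smul_adjoint_apply hv ξ t).le)

theorem memLp_two_inv_cosh_smul_adjoint {v : ℝ → (H →L[ℂ] H)}
    (hv : ∀ t, v t ∈ unitary (H →L[ℂ] H)) (hvcont : ∀ ξ : H, Continuous fun t => v t ξ) (ξ : H) :
    MemLp (fun t : ℝ => (cosh (π * t))⁻¹ • (v t).adjoint ξ) 2 := by
  rw [memLp_two_iff_integrable_sq_norm
    (integrable_inv_cosh_smul_adjoint hv hvcont ξ).aestronglyMeasurable]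
  simp only [norm_inv_cosh_smul_adjoint_apply hv, mul_pow]
  exact integrable_inv_cosh_pi_mul_sq.mul_const _

theorem integral_inner_inv_cosh_smul_adjoint {v : ℝ → (H →L[ℂ] H)}
    (hv : ∀ t, v t ∈ unitary (H →L[ℂ] H)) (ξ η : H) :
    ∫ t : ℝ, ⟪(cosh (π * t))⁻¹ • (v t).adjoint ξ, (cosh (π * t))⁻¹ • (v t).adjoint η⟫_ℂ
      = (2 / π : ℝ) • ⟪ξ, η⟫_ℂ := by
  rw [← integral_inv_cosh_pi_mul_sq, ← integral_smul_const]
  congr! 2 with t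
  rw [inner_smul_left_eq_smul, inner_smul_right_eq_smul, inner_adjoint_apply_of_mem_unitary (hv t),
    smul_smul, sq]

theorem ofReal_exp_cpow_neg_I_mul (w t : ℝ) :
    ((exp (-(2 * π * w)) : ℝ) : ℂ) ^ (-(Complex.I * t)) =
      Complex.exp (↑(2 * π * t * w) * Complex.I) := by
  rw [Complex.cpow_def_of_ne_zero (Complex.ofReal_ne_zero.2 (exp_pos _).ne'), ← Complex.ofReal_log
    (exp_pos _).le, log_exp]
  congr 1
  push_cast
  ring

theorem norm_apply_of_mem_unitary {u : H →L[ℂ] H}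
    (hu : u ∈ unitary (H →L[ℂ] H)) (x : H) : ‖u x‖ = ‖x‖ := by
  rw [← norm_adjoint_apply_of_mem_unitary hu, adjoint_apply_apply_of_mem_unitary hu]

theorem integrable_exp_smul_inv_cosh_smul {v : ℝ → (H →L[ℂ] H)}
    (hv : ∀ t, v t ∈ unitary (H →L[ℂ] H)) (hvcont : ∀ ξ : H, Continuous fun t => v t ξ)
    (w : ℝ) (x : H) :
    Integrable fun t : ℝ =>
      Complex.exp (↑(2 * π * t * w) * Complex.I) • (cosh (π * t))⁻¹ • v t x := by
  refine (integrable_inv_cosh_pi_mul.mul_const ‖x‖).mono' (Continuous.aestronglyMeasurable ?_)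
    (.of_forall fun t => ?_)
  · exact (by fun_prop : Continuous fun t : ℝ => Complex.exp (↑(2 * π * t * w) * Complex.I)).smul
      (continuous_inv_cosh_pi_mul.smul (hvcont x))
  · rw [norm_smul, norm_smul, Complex.norm_exp_ofReal_mul_I, one_mul,
      norm_of_nonneg (inv_nonneg.2 (cosh_pos _).le), norm_apply_of_mem_unitary (hv t)]

/-- An operator given by an oscillatory integral of unitaries against the hyperbolic secant has as
adjoint the Fourier integral of the adjoint family. -/
theorem adjoint_apply_eq_smul_fourier {v : ℝ → (H →L[ℂ] H)}
    (hv : ∀ t, v t ∈ unitary (H →L[ℂ] H)) (hvcont : ∀ ξ : H, Continuous fun t => v t ξ)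
    {T : H →L[ℂ] H} {c w : ℝ}
    (hT : ∀ ξ : H, T ξ = c • ∫ t : ℝ, Complex.exp (↑(2 * π * t * w) * Complex.I) •
      (cosh (π * t))⁻¹ • v t ξ) (ξ : H) :
    T.adjoint ξ = c • 𝓕 (fun t : ℝ => (cosh (π * t))⁻¹ • (v t).adjoint ξ) w := by
  refine ext_inner_left ℂ fun x => ?_
  have hint := integrable_inv_cosh_smul_adjoint hv hvcont ξ
  have hint' : Integrable fun t : ℝ => Complex.exp (↑(-2 * π * t * w) * Complex.I) •
      (cosh (π * t))⁻¹ • (v t).adjoint ξ := by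
    refine hint.mono (AEStronglyMeasurable.smul ?_ hint.aestronglyMeasurable)
      (.of_forall fun t => ?_)
    · exact Continuous.aestronglyMeasurable (by fun_prop)
    · rw [norm_smul, Complex.norm_exp_ofReal_mul_I, one_mul]
  rw [ContinuousLinearMap.adjoint_inner_right, hT, inner_smul_left_eq_smul,
    inner_smul_right_eq_smul, fourier_real_eq_integral_exp_smul, ← integral_inner hint',
    ← inner_conj_symm, ← integral_inner (integrable_exp_smul_inv_cosh_smul hv hvcont w x),
    ← integral_conj]
  congr! 3 with t
  rw [inner_conj_symm, inner_smul_left, inner_smul_right, inner_smul_left_eq_smul,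
    inner_smul_right_eq_smul, ContinuousLinearMap.adjoint_inner_right, ← Complex.exp_conj]
  congr 2
  rw [map_mul, Complex.conj_ofReal, Complex.conj_I]
  push_cast
  ring

end StarUnitary

section ChangeOfVariables

variable {E : Type*} [NormedAddCommGroup E] [NormedSpace ℝ E]

/-- The substitution `l = exp (-2πw)` on `(0, ∞)`. -/
theorem integrableOn_Ioi_iff_and_integral_eq_exp_neg_two_pi_mul (F : ℝ → E) :
    (IntegrableOn F (Set.Ioi 0) ↔
      Integrable fun w : ℝ => (2 * π * exp (-(2 * π * w))) • F (exp (-(2 * π * w)))) ∧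
    ∫ l in Set.Ioi 0, F l = ∫ w : ℝ, (2 * π * exp (-(2 * π * w))) • F (exp (-(2 * π * w))) := by
  have hpi : 2 * π ≠ 0 := by positivity
  have hd (w : ℝ) (_ : w ∈ Set.univ) : HasDerivWithinAt (fun w => exp (-(2 * π * w)))
      (-(2 * π * exp (-(2 * π * w)))) Set.univ w := by
    refine (((hasDerivAt_id w).const_mul (2 * π)).fun_neg.exp.congr_deriv ?_).hasDerivWithinAt
    simp only [id_eq]
    ring
  have hinj : Set.InjOn (fun w => exp (-(2 * π * w))) Set.univ := fun a _ b _ hab =>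
    mul_left_cancel₀ hpi (neg_injective (exp_injective hab))
  have himg : (fun w => exp (-(2 * π * w))) '' Set.univ = Set.Ioi 0 := by
    refine Set.Subset.antisymm (Set.image_subset_iff.2 fun w _ => exp_pos _) fun l hl =>
      ⟨-(log l) / (2 * π), trivial, ?_⟩
    simp only [mul_div_cancel₀ _ hpi, neg_neg, exp_log hl]
  have habs (w : ℝ) : |-(2 * π * exp (-(2 * π * w)))| = 2 * π * exp (-(2 * π * w)) := by
    rw [abs_neg, abs_of_pos (by positivity)]
  have h₁ := integrableOn_image_iff_integrableOn_abs_deriv_smul .univ hd hinj F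
  have h₂ := integral_image_eq_integral_abs_deriv_smul .univ hd hinj F
  simp only [himg, habs, integrableOn_univ, setIntegral_univ] at h₁ h₂
  exact ⟨h₁, h₂⟩

end ChangeOfVariables

/-- Let `v : ℝ → B(H)` be a strongly continuous family of unitaries and, for `λ > 0`,
let `m λ` be the bounded operator given by `m λ ξ = (2√λ)⁻¹ ∫ λ^{-it} cosh(πt)⁻¹ v t ξ dt`.
Then `λ ↦ ⟨(m λ)* ξ, (m λ)* η⟩` is integrable on `(0,∞)` with integral `⟨ξ, η⟩`. -/
theorem stmt2 {H : Type*} [NormedAddCommGroup H] [InnerProductSpace ℂ H] [CompleteSpace H]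
    (v : ℝ → (H →L[ℂ] H)) (hv : ∀ t, v t ∈ unitary (H →L[ℂ] H))
    (hvcont : ∀ ξ : H, Continuous fun t => v t ξ)
    (m : ℝ → (H →L[ℂ] H))
    (hm : ∀ l : ℝ, 0 < l → ∀ ξ : H,
      m l ξ = (2 * Real.sqrt l)⁻¹ •
        ∫ t : ℝ, ((l : ℂ) ^ (-(Complex.I * t))) • (Real.cosh (Real.pi * t))⁻¹ • v t ξ)
    (ξ η : H) :
    IntegrableOn (fun l : ℝ => ⟪(m l).adjoint ξ, (m l).adjoint η⟫_ℂ) (Set.Ioi 0) ∧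
    ∫ l in Set.Ioi (0 : ℝ), ⟪(m l).adjoint ξ, (m l).adjoint η⟫_ℂ = ⟪ξ, η⟫_ℂ := by
  have hfour (w : ℝ) (ζ : H) : (m (exp (-(2 * π * w)))).adjoint ζ =
      (2 * √(exp (-(2 * π * w))))⁻¹ •
        𝓕 (fun t : ℝ => (cosh (π * t))⁻¹ • (v t).adjoint ζ) w := by
    refine adjoint_apply_eq_smul_fourier hv hvcont (fun x => ?_) ζ
    simp only [hm _ (exp_pos _), ofReal_exp_cpow_neg_I_mul]
  have hcoef (w : ℝ) : 2 * π * exp (-(2 * π * w)) * ((2 * √(exp (-(2 * π * w))))⁻¹ *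
      (2 * √(exp (-(2 * π * w))))⁻¹) = π / 2 := by
    rw [← mul_inv, mul_mul_mul_comm, mul_self_sqrt (exp_pos _).le]
    field_simp
  obtain ⟨hiff, heq⟩ := integrableOn_Ioi_iff_and_integral_eq_exp_neg_two_pi_mul
    fun l : ℝ => ⟪(m l).adjoint ξ, (m l).adjoint η⟫_ℂ
  simp only [hfour, inner_smul_left_eq_smul, inner_smul_right_eq_smul, smul_smul, hcoef]
    at hiff heq
  obtain ⟨hint, hval⟩ := integrable_inner_fourier_and_integral_eq
    (integrable_inv_cosh_smul_adjoint hv hvcont ξ) (memLp_two_inv_cosh_smul_adjoint hv hvcont ξ)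
    (integrable_inv_cosh_smul_adjoint hv hvcont η) (memLp_two_inv_cosh_smul_adjoint hv hvcont η)
  refine ⟨hiff.2 (hint.smul (π / 2)), ?_⟩
  rw [heq, integral_smul, hval, integral_inner_inv_cosh_smul_adjoint hv, smul_smul,
    div_mul_div_cancel₀ two_ne_zero, div_self pi_ne_zero, one_smul]
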